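/- Let d ≥ 3 be a prime, F = ℤ/dℤ, and let 0 ≤ R ≤ 1. Then there exists N₀ such that for every n ≥ N₀ there exist a self-orthogonal linear code C_n ⊆ F^n with n − 2·dim_F C_n ≥ nR and a transversal Γ_n of F^n/C_n^⊥ such that for every probability distribution P on X = F×F one has P^n(X^n ∖ K(Γ_n)) ≤ P̄^n(F^n ∖ Γ_n) + P̿^n(F^n ∖ Γ_n) ≤ 2·d^d·(n+1)^{3(d−1)}·d^{−n·min{E*(R,P̄), E*(R,P̿)}}. -/

import Mathlib

/- STATEMENT 0: existence of robust self-orthogonal (CSS) codes with transversals whose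
   error probability obeys the exponential bound
   P^n(Xⁿ∖K(Γₙ)) ≤ P̄^n(Fⁿ∖Γₙ) + P̿^n(Fⁿ∖Γₙ)
                 ≤ 2·d^d·(n+1)^{3(d−1)}·d^{−n·min{E*(R,P̄),E*(R,P̿)}}  for primes d ≥ 3. -/

open scoped BigOperators

noncomputable section

/-- Dot product `x·y = Σᵢ xᵢ yᵢ` in `ℤ/dℤ`. -/
def dotp {d n : ℕ} (x y : Fin n → ZMod d) : ZMod d := ∑ i, x i * y i

/-- `C^⊥ = {y : ∀ x ∈ C, x·y = 0}`. -/
def dualSet {d n : ℕ} (C : Set (Fin n → ZMod d)) : Set (Fin n → ZMod d) :=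
  {y | ∀ x ∈ C, dotp x y = 0}

/-- A transversal of `Fⁿ/C^⊥`: contains exactly one element of each coset of `C^⊥`. -/
def IsTransversal {d n : ℕ} (C : Set (Fin n → ZMod d)) (Γ : Set (Fin n → ZMod d)) : Prop :=
  ∀ y : Fin n → ZMod d, ∃! g, g ∈ Γ ∧ y - g ∈ dualSet C

/-- Probability distribution on a finite set. -/
def IsProbDist {Y : Type*} [Fintype Y] (p : Y → ℝ) : Prop :=
  (∀ a, 0 ≤ p a) ∧ ∑ a, p a = 1

open Classical in
/-- `pn p S = Σ_{y ∈ S} p(y₁)⋯p(y_n)`, the i.i.d. product measure of `S ⊆ Yⁿ`. -/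
def pn {Y : Type*} [Fintype Y] {n : ℕ} (p : Y → ℝ) (S : Set (Fin n → Y)) : ℝ :=
  ∑ y : Fin n → Y, if y ∈ S then ∏ i, p (y i) else 0

/-- First marginal `P̄(i) = Σ_j P(i,j)`. -/
def margin1 {Y : Type*} [Fintype Y] (P : Y × Y → ℝ) : Y → ℝ := fun i => ∑ j, P (i, j)

/-- Second marginal `P̿(i) = Σ_j P(j,i)`. -/
def margin2 {Y : Type*} [Fintype Y] (P : Y × Y → ℝ) : Y → ℝ := fun i => ∑ j, P (j, i)

/-- `K(Γ) = {[x,z] : x ∈ Γ, z ∈ Γ}` where `[x,z]ᵢ = (xᵢ, zᵢ)`. -/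
def Kset {d n : ℕ} (Γ : Set (Fin n → ZMod d)) : Set (Fin n → ZMod d × ZMod d) :=
  {w | ∃ x ∈ Γ, ∃ z ∈ Γ, w = fun i => (x i, z i)}

/-- Base-`d` entropy `H(Q) = −Σ_a Q(a) log_d Q(a)`. -/
def entd (d : ℕ) {Y : Type*} [Fintype Y] (Q : Y → ℝ) : ℝ := -∑ a, Q a * Real.logb d (Q a)

/-- Base-`d` Kullback–Leibler divergence `D(Q‖p) = Σ_a Q(a) log_d (Q(a)/p(a))`. -/
def kld (d : ℕ) {Y : Type*} [Fintype Y] (Q p : Y → ℝ) : ℝ := ∑ a, Q a * Real.logb d (Q a / p a)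

/-- `E*(R,p) = inf_Q [ D(Q‖p) + ½·|1 − 2H(Q) − R|⁺ ]`, the infimum taken over all
probability distributions `Q` on `ℤ/dℤ`; distributions that are not absolutely continuous
with respect to `p` contribute `+∞` and hence are omitted from the infimum. -/
def Estar (d : ℕ) [NeZero d] (R : ℝ) (p : ZMod d → ℝ) : ℝ :=
  sInf {v : ℝ | ∃ Q : ZMod d → ℝ, IsProbDist Q ∧ (∀ a, p a = 0 → Q a = 0) ∧
    v = kld d Q p + 2⁻¹ * max (1 - 2 * entd d Q - R) 0}

lemma inv_two_add_inv_two {d : ℕ} [Fact d.Prime] (hd3 : 3 ≤ d) :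
    (2⁻¹ : ZMod d) + 2⁻¹ = 1 := by
  have h2 : (2 : ZMod d) ≠ 0 := by
    intro h
    have h' : ((2 : ℕ) : ZMod d) = 0 := by exact_mod_cast h
    rw [ZMod.natCast_eq_zero_iff] at h'
    have := Nat.le_of_dvd (by norm_num) h'
    omega
  field_simp
  norm_num

open Matrix in
/-- An orthogonal splitting of the standard quadratic space over `ℤ/dℤ` into a hyperbolic part
(spanned by the columns of the isotropic frames `E` and `F`) and a standard part. -/
lemma exists_hyperbolic_frames {d : ℕ} [Fact d.Prime] (hd3 : 3 ≤ d) {ι : Type} [Fintype ι]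
    [DecidableEq ι] (q r : ℕ) (hι : Fintype.card ι = 4 * q + r) :
    ∃ (E F : Matrix ι (Fin q ⊕ Fin q) (ZMod d)) (G : Matrix ι (Fin r) (ZMod d)),
      Eᵀ * E = 0 ∧ Fᵀ * F = 0 ∧ Eᵀ * F = 1 ∧ Eᵀ * G = 0 ∧ Fᵀ * G = 0 ∧ Gᵀ * G = 1 ∧
      E * Fᵀ + F * Eᵀ + G * Gᵀ = 1 := by
  obtain ⟨a, b, hab⟩ := ZMod.sq_add_sq d (-1)
  have hhalf := inv_two_add_inv_two (d := d) hd3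
  let J : Matrix (Fin q ⊕ Fin q) (Fin q ⊕ Fin q) (ZMod d) :=
    fromBlocks (a • 1) (b • 1) ((-b) • 1) (a • 1)
  have hneg : (-1 : Matrix (Fin q ⊕ Fin q) (Fin q ⊕ Fin q) (ZMod d))
      = fromBlocks ((-1 : ZMod d) • 1) 0 0 ((-1 : ZMod d) • 1) := by
    rw [← fromBlocks_one, fromBlocks_neg]; simp
  have hJ1 : Jᵀ * J = -1 := by
    rw [hneg]
    simp only [J, fromBlocks_transpose, fromBlocks_multiply, transpose_smul, transpose_one,
      smul_mul_smul_comm, mul_one, ← add_smul]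
    congr 1
    · congr 1; linear_combination hab
    · rw [show a * b + -b * a = 0 by ring, zero_smul]
    · rw [show b * a + a * -b = 0 by ring, zero_smul]
    · congr 1; linear_combination hab
  have hJ2 : J * Jᵀ = -1 := by
    rw [hneg]
    simp only [J, fromBlocks_transpose, fromBlocks_multiply, transpose_smul, transpose_one,
      smul_mul_smul_comm, mul_one, ← add_smul]
    congr 1
    · congr 1; linear_combination hab
    · rw [show a * -b + b * a = 0 by ring, zero_smul]
    · rw [show -b * a + a * b = 0 by ring, zero_smul]
    · congr 1; linear_combination hab
  let e : ι ≃ ((Fin q ⊕ Fin q) ⊕ (Fin q ⊕ Fin q)) ⊕ Fin r :=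
    Fintype.equivOfCardEq (by simp [hι]; ring)
  let E : Matrix (((Fin q ⊕ Fin q) ⊕ (Fin q ⊕ Fin q)) ⊕ Fin r) (Fin q ⊕ Fin q) (ZMod d) :=
    fromRows (fromRows 1 J) 0
  let F : Matrix (((Fin q ⊕ Fin q) ⊕ (Fin q ⊕ Fin q)) ⊕ Fin r) (Fin q ⊕ Fin q) (ZMod d) :=
    fromRows (fromRows ((2⁻¹ : ZMod d) • 1) ((2⁻¹ : ZMod d) • -J)) 0
  let G : Matrix (((Fin q ⊕ Fin q) ⊕ (Fin q ⊕ Fin q)) ⊕ Fin r) (Fin r) (ZMod d) :=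
    fromRows (fromRows 0 0) 1
  refine ⟨E.submatrix e id, F.submatrix e id, G.submatrix e id, ?_, ?_, ?_, ?_, ?_, ?_, ?_⟩
  · simp only [transpose_submatrix, submatrix_mul_equiv]
    simp [E, transpose_fromRows, fromCols_mul_fromRows, hJ1]
  · simp only [transpose_submatrix, submatrix_mul_equiv]
    simp [F, transpose_fromRows, fromCols_mul_fromRows, hJ1]
  · simp only [transpose_submatrix, submatrix_mul_equiv]
    simp [E, F, transpose_fromRows, fromCols_mul_fromRows, hJ1, ← add_smul, hhalf]
  · simp only [transpose_submatrix, submatrix_mul_equiv]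
    simp [E, G, transpose_fromRows, fromCols_mul_fromRows]
  · simp only [transpose_submatrix, submatrix_mul_equiv]
    simp [F, G, transpose_fromRows, fromCols_mul_fromRows]
  · simp only [transpose_submatrix, submatrix_mul_equiv]
    simp [G, transpose_fromRows, fromCols_mul_fromRows]
  · have key : E * Fᵀ + F * Eᵀ + G * Gᵀ = 1 := by
      ext ((i | i) | i) ((j | j) | j) <;>
        simp [E, F, G, transpose_fromRows, fromRows_mul, mul_fromCols, hJ2, one_apply]
      all_goals split_ifs <;> simp [hhalf]
    simp only [transpose_submatrix, ← submatrix_mul _ _ e id e Function.bijective_id]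
    rw [← submatrix_one_equiv e, ← key]
    rfl

/-- A fibre of an additive map is small if the map is injective on a large family. -/
lemma card_fiber_mul_card_le {G H P : Type*} [AddCommGroup G] [AddCommGroup H] [Fintype G]
    [Fintype P] [DecidableEq H] (f : G →+ H) (φ : P → G)
    (hφ : Function.Injective fun p => f (φ p)) (c : H) :
    (Finset.univ.filter fun g => f g = c).card * Fintype.card P ≤ Fintype.card G := by
  rw [← Fintype.card_coe, ← Fintype.card_prod]
  refine Fintype.card_le_of_injective (fun x => (x.1 : G) + φ x.2) ?_
  rintro ⟨⟨g, hg⟩, p⟩ ⟨⟨g', hg'⟩, p'⟩ h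
  simp only [Finset.mem_filter, Finset.mem_univ, true_and] at hg hg'
  have h1 : f (φ p) = f (φ p') := by
    have := congrArg f h
    simpa [hg, hg'] using this
  obtain rfl := hφ h1
  simpa using h

open Matrix in
lemma card_transpose_mulVec_eq_mul_le {K I L : Type*} [Field K] [Fintype K] [DecidableEq K]
    [Fintype I] [DecidableEq I] [Fintype L] [DecidableEq L] {w : I → K} (hw : w ≠ 0) (c : L → K) :
    (Finset.univ.filter fun B : Matrix I L K => Bᵀ *ᵥ w = c).card
      * Fintype.card K ^ Fintype.card L ≤ Fintype.card (Matrix I L K) := by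
  obtain ⟨i, hi⟩ := Function.ne_iff.mp hw
  let f : Matrix I L K →+ (L → K) :=
    { toFun := fun B => Bᵀ *ᵥ w
      map_zero' := by simp
      map_add' := fun A B => by simp [add_mulVec] }
  rw [← Fintype.card_fun]
  refine card_fiber_mul_card_le f (fun p : L → K => vecMulVec (Pi.single i 1) p) ?_ c
  intro p p' h
  ext l
  have := congrFun h l
  have hi' : w i ≠ 0 := hi
  simpa [f, transpose_vecMulVec, vecMulVec_mulVec, hi'] using this

open Matrix in
lemma card_skew_mulVec_eq_mul_le {K I : Type*} [Field K] [Fintype K] [DecidableEq K]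
    [Fintype I] [DecidableEq I] {u : I → K} (hu : u ≠ 0) (c : I → K) :
    (Finset.univ.filter fun Z : Matrix I I K => (Zᵀ - Z) *ᵥ u = c).card
      * Fintype.card K ^ (Fintype.card I - 1) ≤ Fintype.card (Matrix I I K) := by
  obtain ⟨i, hi⟩ := Function.ne_iff.mp hu
  let f : Matrix I I K →+ (I → K) :=
    { toFun := fun Z => (Zᵀ - Z) *ᵥ u
      map_zero' := by simp
      map_add' := fun A B => by simp [sub_mulVec, add_mulVec]; abel }
  have hc : Fintype.card {j // j ≠ i} = Fintype.card I - 1 := by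
    simp [Fintype.card_subtype_compl]
  rw [← hc, ← Fintype.card_fun]
  refine card_fiber_mul_card_le f (fun p : {j // j ≠ i} → K =>
    vecMulVec (fun j => if h : j ≠ i then p ⟨j, h⟩ else 0) (Pi.single i 1)) ?_ c
  intro p p' h
  ext ⟨l, hl⟩
  have := congrFun h l
  have hi' : u i ≠ 0 := hi
  simpa [f, transpose_vecMulVec, sub_mulVec, vecMulVec_mulVec, Pi.single_apply, hi', hl] using this

open Matrix in
/-- A finite ensemble of self-orthogonal codes of dimension at most `k` whose duals contain every
fixed nonzero word with small probability, built from frames as in `exists_hyperbolic_frames`. -/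
lemma exists_selfOrthogonal_ensemble_of_frames {d : ℕ} [Fact d.Prime] (hd3 : 3 ≤ d)
    {I J : Type} [Fintype I] [DecidableEq I] [Fintype J] [DecidableEq J] (n k : ℕ)
    (E F : Matrix (Fin n) I (ZMod d)) (G : Matrix (Fin n) J (ZMod d))
    (hEE : Eᵀ * E = 0) (hFF : Fᵀ * F = 0) (hEF : Eᵀ * F = 1) (hEG : Eᵀ * G = 0)
    (hFG : Fᵀ * G = 0) (hGG : Gᵀ * G = 1) (hone : E * Fᵀ + F * Eᵀ + G * Gᵀ = 1) :
    ∃ (Ω : Type) (_ : Fintype Ω) (_ : Nonempty Ω)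
      (C : Ω → Submodule (ZMod d) (Fin n → ZMod d)),
      (∀ ω, (C ω : Set (Fin n → ZMod d)) ⊆ dualSet (C ω : Set (Fin n → ZMod d))) ∧
      (∀ ω, Module.finrank (ZMod d) (C ω) ≤ k) ∧
      ∀ y : Fin n → ZMod d, y ≠ 0 →
        (Nat.card {ω // y ∈ dualSet (C ω : Set (Fin n → ZMod d))} : ℝ) ≤
          (((d : ℝ) ^ k)⁻¹ + ((d : ℝ) ^ (Fintype.card I - 1))⁻¹) * Fintype.card Ω := by
  classical
  have hFE : Fᵀ * E = 1 := by simpa using congrArg transpose hEF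
  have hGE : Gᵀ * E = 0 := by simpa using congrArg transpose hEG
  have hGF : Gᵀ * F = 0 := by simpa using congrArg transpose hFG
  have hhalf := inv_two_add_inv_two (d := d) hd3
  let S : Matrix I I (ZMod d) → Matrix J I (ZMod d) → Matrix I I (ZMod d) := fun Z T =>
    Z - Zᵀ - (2⁻¹ : ZMod d) • (Tᵀ * T)
  have hS : ∀ Z T, S Z T + (S Z T)ᵀ + Tᵀ * T = 0 := by
    intro Z T
    have h1 : Tᵀ * T = (2⁻¹ : ZMod d) • (Tᵀ * T) + (2⁻¹ : ZMod d) • (Tᵀ * T) := by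
      rw [← add_smul, hhalf, one_smul]
    simp only [S, transpose_sub, transpose_smul, transpose_mul, transpose_transpose]
    conv_lhs => arg 2; rw [h1]
    abel
  let M : Matrix I I (ZMod d) → Matrix J I (ZMod d) → Matrix (Fin n) I (ZMod d) := fun Z T =>
    E + F * S Z T + G * T
  have hM : ∀ Z T, (M Z T)ᵀ * M Z T = 0 := by
    intro Z T
    have : (M Z T)ᵀ * M Z T = Eᵀ * E + (Eᵀ * F) * S Z T + (Eᵀ * G) * T
        + (S Z T)ᵀ * (Fᵀ * E) + (S Z T)ᵀ * (Fᵀ * F) * S Z T + (S Z T)ᵀ * (Fᵀ * G) * T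
        + Tᵀ * (Gᵀ * E) + Tᵀ * (Gᵀ * F) * S Z T + Tᵀ * (Gᵀ * G) * T := by
      simp only [M, transpose_add, transpose_mul, Matrix.add_mul, Matrix.mul_add, Matrix.mul_assoc]
      abel
    rw [this, hEE, hFF, hEF, hEG, hFG, hGG, hFE, hGE, hGF]
    simpa using hS Z T
  let C : Matrix I I (ZMod d) × Matrix J I (ZMod d) × Matrix I (Fin k) (ZMod d) →
      Submodule (ZMod d) (Fin n → ZMod d) := fun ω =>
    LinearMap.range (M ω.1 ω.2.1 * ω.2.2).mulVecLin
  have hdot : ∀ (x y : Fin n → ZMod d), dotp x y = x ⬝ᵥ y := fun x y => rfl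
  have hdual : ∀ ω y, y ∈ dualSet (C ω : Set (Fin n → ZMod d)) ↔
      ω.2.2ᵀ *ᵥ ((M ω.1 ω.2.1)ᵀ *ᵥ y) = 0 := by
    intro ω y
    rw [mulVec_mulVec, ← transpose_mul, mulVec_transpose]
    constructor
    · intro h
      refine dotProduct_eq_zero _ fun v => ?_
      rw [← dotProduct_mulVec, dotProduct_comm]
      exact (hdot _ _).symm.trans <| h _ ⟨v, by simp⟩
    · rintro h _ ⟨v, rfl⟩
      rw [hdot, dotProduct_comm, mulVecLin_apply, dotProduct_mulVec, h, zero_dotProduct]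
  refine ⟨_, inferInstance, inferInstance, C, ?_, ?_, ?_⟩
  · rintro ω _ ⟨v, rfl⟩
    rw [hdual, mulVecLin_apply, mulVec_mulVec, mulVec_mulVec, Matrix.mul_assoc,
      ← Matrix.mul_assoc (M ω.1 ω.2.1)ᵀ, hM]
    simp
  · intro ω
    exact (LinearMap.finrank_range_le _).trans (by simp)
  · intro y hy
    set v := Eᵀ *ᵥ y with hv
    set u := Fᵀ *ᵥ y with hu
    set w := Gᵀ *ᵥ y with hw
    let g : Matrix I I (ZMod d) → Matrix J I (ZMod d) → I → ZMod d := fun Z T =>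
      (M Z T)ᵀ *ᵥ y
    have hg : ∀ Z T, g Z T = v + (S Z T)ᵀ *ᵥ u + Tᵀ *ᵥ w := by
      intro Z T
      simp only [g, M, transpose_add, transpose_mul, add_mulVec, ← mulVec_mulVec, hv, hu, hw]
    have hyeq : y = E *ᵥ u + F *ᵥ v + G *ᵥ w := by
      simp only [hv, hu, hw, mulVec_mulVec, ← add_mulVec, hone, one_mulVec]
    -- probability that the functional induced by `y` on the maximal code vanishes
    have hfirst : (Finset.univ.filter fun p : _ × _ => g p.1 p.2 = 0).card *
        d ^ (Fintype.card I - 1) ≤ Fintype.card (Matrix I I (ZMod d)) * Fintype.card (Matrix J I (ZMod d)) := by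
      by_cases hu0 : u = 0
      · by_cases hw0 : w = 0
        · have hv0 : v ≠ 0 := by
            intro hv0
            apply hy
            rw [hyeq, hu0, hw0, hv0]; simp
          have : (Finset.univ.filter fun p : _ × _ => g p.1 p.2 = 0) = ∅ := by
            ext p; simp [hg, hu0, hw0, hv0]
          rw [this]; simp
        · have hsub : (Finset.univ.filter fun p : _ × _ => g p.1 p.2 = 0) =
              Finset.univ ×ˢ (Finset.univ.filter fun T : Matrix J I (ZMod d) => Tᵀ *ᵥ w = -v) := by
            ext p
            simp [hg, hu0, eq_neg_iff_add_eq_zero, add_comm]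
          rw [hsub, Finset.card_product, mul_assoc, Finset.card_univ]
          refine Nat.mul_le_mul_left _ (le_trans (Nat.mul_le_mul_left _ ?_)
            (card_transpose_mulVec_eq_mul_le hw0 (-v)))
          rw [ZMod.card]
          exact Nat.pow_le_pow_right (by omega) (Nat.sub_le _ _)
      · have hcount : (Finset.univ.filter fun p : _ × _ => g p.1 p.2 = 0).card =
            ∑ T, (Finset.univ.filter fun Z => g Z T = 0).card := by
          simp only [Finset.card_filter]
          rw [Fintype.sum_prod_type_right]
        rw [hcount, Finset.sum_mul, mul_comm (Fintype.card (Matrix I I (ZMod d)))]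
        refine (Finset.sum_le_card_nsmul _ _ (Fintype.card (Matrix I I (ZMod d)))
          fun T _ => ?_).trans (by simp)
        have := card_skew_mulVec_eq_mul_le (K := ZMod d) (I := I) hu0
          (-v - Tᵀ *ᵥ w + ((2⁻¹ : ZMod d) • (Tᵀ * T)) *ᵥ u)
        rw [ZMod.card] at this
        refine le_of_eq_of_le ?_ this
        congr 2
        refine Finset.filter_congr fun Z _ => ?_
        rw [hg]
        simp only [S, transpose_sub, transpose_smul, transpose_mul, transpose_transpose]
        rw [sub_mulVec (Zᵀ - Z)]
        rw [← sub_eq_zero (a := (Zᵀ - Z) *ᵥ u)]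
        constructor <;> intro h <;> rw [← h] <;> abel
    have hsecond : (Finset.univ.filter fun ω : _ × _ × Matrix I (Fin k) (ZMod d) =>
          g ω.1 ω.2.1 ≠ 0 ∧ ω.2.2ᵀ *ᵥ g ω.1 ω.2.1 = 0).card * d ^ k ≤
          Fintype.card (Matrix I I (ZMod d) × Matrix J I (ZMod d) × Matrix I (Fin k) (ZMod d)) := by
      have hcount : (Finset.univ.filter fun ω : _ × _ × Matrix I (Fin k) (ZMod d) =>
          g ω.1 ω.2.1 ≠ 0 ∧ ω.2.2ᵀ *ᵥ g ω.1 ω.2.1 = 0).card =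
          ∑ Z, ∑ T, (Finset.univ.filter fun B : Matrix I (Fin k) (ZMod d) =>
            g Z T ≠ 0 ∧ Bᵀ *ᵥ g Z T = 0).card := by
        simp only [Finset.card_filter, Fintype.sum_prod_type]
      rw [hcount, Finset.sum_mul, Fintype.card_prod, Fintype.card_prod]
      refine (Finset.sum_le_card_nsmul _ _
        (Fintype.card (Matrix J I (ZMod d)) * Fintype.card (Matrix I (Fin k) (ZMod d)))
        fun Z _ => ?_).trans (by simp)
      rw [Finset.sum_mul]
      refine (Finset.sum_le_card_nsmul _ _ (Fintype.card (Matrix I (Fin k) (ZMod d)))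
        fun T _ => ?_).trans (by simp)
      by_cases h0 : g Z T = 0
      · simp [h0]
      · have := card_transpose_mulVec_eq_mul_le (L := Fin k) h0 0
        simpa [h0] using this
    have hthird : (Finset.univ.filter fun ω : _ × _ × Matrix I (Fin k) (ZMod d) =>
          g ω.1 ω.2.1 = 0).card
        * d ^ (Fintype.card I - 1) ≤
          Fintype.card (Matrix I I (ZMod d) × Matrix J I (ZMod d) × Matrix I (Fin k) (ZMod d)) := by
      have hcount : (Finset.univ.filter fun ω : _ × _ × Matrix I (Fin k) (ZMod d) =>
          g ω.1 ω.2.1 = 0).card =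
          (Finset.univ.filter fun p : _ × _ => g p.1 p.2 = 0).card *
            Fintype.card (Matrix I (Fin k) (ZMod d)) := by
        simp only [Finset.card_filter, Fintype.sum_prod_type, Finset.sum_mul]
        refine Finset.sum_congr rfl fun Z _ => Finset.sum_congr rfl fun T _ => ?_
        by_cases h : g Z T = 0 <;> simp [h]
      rw [hcount, Fintype.card_prod, Fintype.card_prod, ← mul_assoc, mul_right_comm]
      exact Nat.mul_le_mul_right _ hfirst
    have hsplit : Nat.card {ω // y ∈ dualSet (C ω : Set (Fin n → ZMod d))} ≤
        (Finset.univ.filter fun ω : _ × _ × Matrix I (Fin k) (ZMod d) =>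
          g ω.1 ω.2.1 ≠ 0 ∧ ω.2.2ᵀ *ᵥ g ω.1 ω.2.1 = 0).card +
        (Finset.univ.filter fun ω : _ × _ × Matrix I (Fin k) (ZMod d) =>
          g ω.1 ω.2.1 = 0).card := by
      rw [Nat.card_eq_fintype_card, Fintype.card_subtype]
      refine (Finset.card_le_card ?_).trans (Finset.card_union_le _ _)
      intro ω hω
      simp only [Finset.mem_filter, Finset.mem_univ, true_and, Finset.mem_union, hdual] at hω ⊢
      by_cases h0 : g ω.1 ω.2.1 = 0
      · exact Or.inr h0
      · exact Or.inl ⟨h0, hω⟩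
    have h1 : ((Finset.univ.filter fun ω : _ × _ × Matrix I (Fin k) (ZMod d) =>
          g ω.1 ω.2.1 ≠ 0 ∧ ω.2.2ᵀ *ᵥ g ω.1 ω.2.1 = 0).card : ℝ) ≤
        ((d : ℝ) ^ k)⁻¹ *
          Fintype.card (Matrix I I (ZMod d) × Matrix J I (ZMod d) × Matrix I (Fin k) (ZMod d)) := by
      rw [inv_mul_eq_div, le_div_iff₀ (by positivity)]
      exact_mod_cast hsecond
    have h3 : ((Finset.univ.filter fun ω : _ × _ × Matrix I (Fin k) (ZMod d) =>
          g ω.1 ω.2.1 = 0).card : ℝ) ≤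
        ((d : ℝ) ^ (Fintype.card I - 1))⁻¹ *
          Fintype.card (Matrix I I (ZMod d) × Matrix J I (ZMod d) × Matrix I (Fin k) (ZMod d)) := by
      rw [inv_mul_eq_div, le_div_iff₀ (by positivity)]
      exact_mod_cast hthird
    rw [add_mul]
    refine le_trans ?_ (add_le_add h1 h3)
    exact_mod_cast hsplit

/-- A finite ensemble of self-orthogonal codes of dimension at most `k` whose duals contain every
fixed nonzero word with small probability. -/
lemma exists_selfOrthogonal_ensemble {d : ℕ} [Fact d.Prime] (hd3 : 3 ≤ d) (n q r k : ℕ)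
    (hn : n = 4 * q + r) :
    ∃ (Ω : Type) (_ : Fintype Ω) (_ : Nonempty Ω)
      (C : Ω → Submodule (ZMod d) (Fin n → ZMod d)),
      (∀ ω, (C ω : Set (Fin n → ZMod d)) ⊆ dualSet (C ω : Set (Fin n → ZMod d))) ∧
      (∀ ω, Module.finrank (ZMod d) (C ω) ≤ k) ∧
      ∀ y : Fin n → ZMod d, y ≠ 0 →
        (Nat.card {ω // y ∈ dualSet (C ω : Set (Fin n → ZMod d))} : ℝ) ≤
          (((d : ℝ) ^ k)⁻¹ + ((d : ℝ) ^ (2 * q - 1))⁻¹) * Fintype.card Ω := by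
  obtain ⟨E, F, G, hEE, hFF, hEF, hEG, hFG, hGG, hone⟩ :=
    exists_hyperbolic_frames (d := d) hd3 (ι := Fin n) q r (by simp [hn])
  have := exists_selfOrthogonal_ensemble_of_frames hd3 n k E F G hEE hFF hEF hEG hFG hGG hone
  rwa [Fintype.card_sum, Fintype.card_fin, ← two_mul] at this

/-- Number of occurrences of each letter in a word. -/
def letterCount {Y : Type*} [DecidableEq Y] {n : ℕ} (x : Fin n → Y) (a : Y) : ℕ :=
  (Finset.univ.filter fun i => x i = a).card

/-- The relative frequencies associated with the letter counts `t` of a word of length `n`. -/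
def freq {Y : Type*} (n : ℕ) (t : Y → ℕ) (a : Y) : ℝ := (t a : ℝ) / n

lemma sum_letterCount {Y : Type*} [DecidableEq Y] [Fintype Y] {n : ℕ} (x : Fin n → Y) :
    ∑ a, letterCount x a = n := by
  have := Finset.card_eq_sum_card_fiberwise (f := x) (s := Finset.univ) (t := Finset.univ)
    (by simp)
  simpa [letterCount] using this.symm

lemma prod_eq_prod_pow_letterCount {Y : Type*} [DecidableEq Y] [Fintype Y] {n : ℕ}
    (x : Fin n → Y) (p : Y → ℝ) : ∏ i, p (x i) = ∏ a, p a ^ letterCount x a := by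
  rw [← Finset.prod_fiberwise Finset.univ x]
  refine Finset.prod_congr rfl fun a _ => ?_
  rw [letterCount, ← Finset.prod_const]
  exact Finset.prod_congr rfl fun i hi => by rw [(Finset.mem_filter.mp hi).2]

lemma isProbDist_freq {Y : Type*} [DecidableEq Y] [Fintype Y] {n : ℕ} (hn : 0 < n)
    (x : Fin n → Y) : IsProbDist (freq n (letterCount x)) := by
  refine ⟨fun a => by unfold freq; positivity, ?_⟩
  simp only [freq, ← Finset.sum_div]
  rw [← Nat.cast_sum, sum_letterCount]
  field_simp

lemma sum_prod_eq_one {Y : Type*} [Fintype Y] {p : Y → ℝ} (hp : IsProbDist p) (n : ℕ) :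
    ∑ x : Fin n → Y, ∏ i, p (x i) = 1 := by
  classical
  have := Finset.prod_univ_sum (fun _ : Fin n => (Finset.univ : Finset Y)) (fun _ a => p a)
  rw [Fintype.piFinset_univ] at this
  rw [← this]
  simp [hp.2]

/-- The words with given letter counts. -/
def typeClass {Y : Type*} [DecidableEq Y] [Fintype Y] (n : ℕ) (t : Y → ℕ) :
    Finset (Fin n → Y) := Finset.univ.filter fun x => letterCount x = t

/-- The letter counts of all words of length `n`. -/
def types (Y : Type*) [DecidableEq Y] [Fintype Y] (n : ℕ) : Finset (Y → ℕ) :=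
  Finset.univ.image (letterCount (n := n))

lemma card_types_le (Y : Type*) [DecidableEq Y] [Fintype Y] [Nonempty Y] (n : ℕ) :
    (types Y n).card ≤ (n + 1) ^ (Fintype.card Y - 1) := by
  obtain ⟨a₀⟩ := ‹Nonempty Y›
  have hc : Fintype.card {a // a ≠ a₀} = Fintype.card Y - 1 := by
    simp [Fintype.card_subtype_compl]
  have hsum : ∀ t ∈ types Y n, ∑ a, t a = n := by
    intro t ht
    obtain ⟨x, -, rfl⟩ := Finset.mem_image.mp ht
    exact sum_letterCount x
  have hlt : ∀ t ∈ types Y n, ∀ a, t a < n + 1 := by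
    intro t ht a
    have := Finset.single_le_sum (f := t) (fun _ _ => Nat.zero_le _) (Finset.mem_univ a)
    rw [hsum t ht] at this
    omega
  have hcard : (n + 1) ^ (Fintype.card Y - 1) = Fintype.card ({a // a ≠ a₀} → Fin (n + 1)) := by
    rw [Fintype.card_fun, hc, Fintype.card_fin]
  rw [hcard, ← Fintype.card_coe]
  refine Fintype.card_le_of_injective
    (fun t a => (⟨t.1 a.1, hlt t.1 t.2 a.1⟩ : Fin (n + 1))) ?_
  rintro ⟨t, ht⟩ ⟨t', ht'⟩ h
  have hne : ∀ a, a ≠ a₀ → t a = t' a := by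
    intro a ha
    have := congrFun h ⟨a, ha⟩
    simpa using this
  have h0 : t a₀ = t' a₀ := by
    have h1 := (hsum t ht).trans (hsum t' ht').symm
    rw [← Finset.add_sum_erase _ _ (Finset.mem_univ a₀),
      ← Finset.add_sum_erase _ t' (Finset.mem_univ a₀),
      Finset.sum_congr rfl fun a ha => hne a (Finset.ne_of_mem_erase ha)] at h1
    exact Nat.add_right_cancel h1
  apply Subtype.ext
  funext a
  by_cases ha : a = a₀
  · rw [ha]; exact h0
  · exact hne a ha

lemma prod_freq_eq {Y : Type*} [DecidableEq Y] [Fintype Y] {d n : ℕ} (hd : 2 ≤ d) (hn : 0 < n)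
    (x : Fin n → Y) :
    ∏ i, freq n (letterCount x) (x i) =
      (d : ℝ) ^ (-((n : ℝ) * entd d (freq n (letterCount x)))) := by
  have hd1 : (1 : ℝ) < d := by exact_mod_cast hd
  rw [prod_eq_prod_pow_letterCount, entd, mul_neg, neg_neg, Finset.mul_sum,
    Real.rpow_sum_of_pos (by linarith)]
  refine Finset.prod_congr rfl fun a _ => ?_
  rcases Nat.eq_zero_or_pos (letterCount x a) with h | h
  · simp [h, freq]
  · have hq : 0 < freq n (letterCount x) a := by unfold freq; positivity
    have : (n : ℝ) * (freq n (letterCount x) a * Real.logb d (freq n (letterCount x) a)) =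
        Real.logb d (freq n (letterCount x) a) * (letterCount x a : ℕ) := by
      nth_rw 1 [freq]; field_simp
    rw [this, Real.rpow_mul (by linarith), Real.rpow_logb (by linarith) (by linarith) hq,
      Real.rpow_natCast]

lemma prod_eq_of_mem_typeClass {Y : Type*} [DecidableEq Y] [Fintype Y] {n : ℕ} {t : Y → ℕ}
    {x : Fin n → Y} (hx : x ∈ typeClass n t) (p : Y → ℝ) :
    ∏ i, p (x i) = ∏ a, p a ^ t a := by
  rw [prod_eq_prod_pow_letterCount, (Finset.mem_filter.mp hx).2]

lemma card_typeClass_mul_prod_le_one {Y : Type*} [DecidableEq Y] [Fintype Y] {n : ℕ}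
    (t : Y → ℕ) {p : Y → ℝ} (hp : IsProbDist p) :
    ((typeClass n t).card : ℝ) * ∏ a, p a ^ t a ≤ 1 := by
  rw [← sum_prod_eq_one hp n, ← nsmul_eq_mul, ← Finset.sum_const,
    ← Finset.sum_congr rfl fun x hx => prod_eq_of_mem_typeClass hx p]
  exact Finset.sum_le_univ_sum_of_nonneg fun x => Finset.prod_nonneg fun i _ => hp.1 _

lemma card_typeClass_le {Y : Type*} [DecidableEq Y] [Fintype Y] {d n : ℕ} (hd : 2 ≤ d)
    (hn : 0 < n) {t : Y → ℕ} (ht : t ∈ types Y n) :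
    ((typeClass n t).card : ℝ) ≤ (d : ℝ) ^ ((n : ℝ) * entd d (freq n t)) := by
  obtain ⟨x, -, rfl⟩ := Finset.mem_image.mp ht
  have hd0 : (0 : ℝ) < d := by positivity
  have h := card_typeClass_mul_prod_le_one (n := n) (letterCount x) (isProbDist_freq hn x)
  rw [← prod_eq_prod_pow_letterCount, prod_freq_eq hd hn, Real.rpow_neg hd0.le,
    ← div_eq_mul_inv, div_le_one (by positivity)] at h
  exact h

/-- The probability of a type class is at most `d ^ (-n D)`. -/
lemma card_typeClass_mul_prod_le {Y : Type*} [DecidableEq Y] [Fintype Y] {d n : ℕ} (hd : 2 ≤ d)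
    (hn : 0 < n) {t : Y → ℕ} (ht : t ∈ types Y n) {p : Y → ℝ} (hp : IsProbDist p)
    (hac : ∀ a, p a = 0 → freq n t a = 0) :
    ((typeClass n t).card : ℝ) * ∏ a, p a ^ t a ≤
      (d : ℝ) ^ (-((n : ℝ) * kld d (freq n t) p)) := by
  have hd1 : (1 : ℝ) < d := by exact_mod_cast hd
  have key : ∏ a, p a ^ t a = (∏ a, freq n t a ^ t a) *
      (d : ℝ) ^ (-((n : ℝ) * kld d (freq n t) p)) := by
    rw [kld, Finset.mul_sum, ← Finset.sum_neg_distrib, Real.rpow_sum_of_pos (by linarith),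
      ← Finset.prod_mul_distrib]
    refine Finset.prod_congr rfl fun a _ => ?_
    rcases Nat.eq_zero_or_pos (t a) with h | h
    · simp [h, freq]
    · have hq : 0 < freq n t a := by unfold freq; positivity
      have hpa : 0 < p a := lt_of_le_of_ne (hp.1 a) fun h0 => hq.ne' (hac a h0.symm)
      have : -((n : ℝ) * (freq n t a * Real.logb d (freq n t a / p a))) =
          Real.logb d (freq n t a / p a) * (-(t a : ℝ)) := by
        nth_rw 1 [freq]; field_simp
      rw [this, Real.rpow_mul (by linarith), Real.rpow_logb (by linarith) (by linarith)
        (by positivity), Real.rpow_neg (by positivity), Real.rpow_natCast, div_pow]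
      field_simp
  obtain ⟨x, -, rfl⟩ := Finset.mem_image.mp ht
  rw [key, ← mul_assoc]
  refine mul_le_of_le_one_left (by positivity) ?_
  exact card_typeClass_mul_prod_le_one _ (isProbDist_freq hn x)

lemma kld_nonneg {Y : Type*} [Fintype Y] {d : ℕ} (hd : 2 ≤ d) {Q p : Y → ℝ} (hQ : IsProbDist Q)
    (hp : IsProbDist p) (hac : ∀ a, p a = 0 → Q a = 0) : 0 ≤ kld d Q p := by
  have hlog : 0 < Real.log d := Real.log_pos (by exact_mod_cast hd)
  have h : ∑ a, (Q a - p a) / Real.log d ≤ kld d Q p := by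
    refine Finset.sum_le_sum fun a _ => ?_
    rw [Real.logb, mul_div_assoc', div_le_div_iff_of_pos_right hlog]
    rcases (hQ.1 a).eq_or_lt with h0 | h0
    · simp [← h0, hp.1 a]
    · have hpa : 0 < p a := lt_of_le_of_ne (hp.1 a) fun h1 => h0.ne' (hac a h1.symm)
      have := Real.one_sub_inv_le_log_of_pos (div_pos h0 hpa)
      calc Q a - p a = Q a * (1 - (Q a / p a)⁻¹) := by field_simp
        _ ≤ _ := by gcongr
  rwa [← Finset.sum_div, Finset.sum_sub_distrib, hQ.2, hp.2, sub_self, zero_div] at h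

lemma Estar_le {d : ℕ} [NeZero d] (hd : 2 ≤ d) (R : ℝ) {Q p : ZMod d → ℝ} (hQ : IsProbDist Q)
    (hp : IsProbDist p) (hac : ∀ a, p a = 0 → Q a = 0) :
    Estar d R p ≤ kld d Q p + 2⁻¹ * max (1 - 2 * entd d Q - R) 0 := by
  refine csInf_le ⟨0, ?_⟩ ⟨Q, hQ, hac, rfl⟩
  rintro _ ⟨Q', hQ', hac', rfl⟩
  have := kld_nonneg hd hQ' hp hac'
  positivity

/-- A transversal consisting of minimizers of `h` in the cosets. -/
lemma exists_transversal_minimizing {d n : ℕ} [NeZero d]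
    (C : Submodule (ZMod d) (Fin n → ZMod d)) (h : (Fin n → ZMod d) → ℝ) :
    ∃ Γ : Set (Fin n → ZMod d), IsTransversal (C : Set (Fin n → ZMod d)) Γ ∧
      ∀ x ∉ Γ, ∃ g, g ≠ x ∧ x - g ∈ dualSet (C : Set (Fin n → ZMod d)) ∧ h g ≤ h x := by
  let D : AddSubgroup (Fin n → ZMod d) :=
    { carrier := dualSet (C : Set (Fin n → ZMod d))
      zero_mem' := fun x _ => by simp [dotp]
      add_mem' := fun {y z} hy hz x hx => by
        have := congrArg₂ (· + ·) (hy x hx) (hz x hx)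
        simpa [dotp, mul_add, Finset.sum_add_distrib] using this
      neg_mem' := fun {y} hy x hx => by
        have := congrArg (-·) (hy x hx)
        simpa [dotp] using this }
  have hD : ∀ y, y ∈ dualSet (C : Set (Fin n → ZMod d)) ↔ y ∈ D := fun y => Iff.rfl
  have hex : ∀ c : (Fin n → ZMod d) ⧸ D, ∃ x : Fin n → ZMod d, (x : (Fin n → ZMod d) ⧸ D) = c ∧
      ∀ y : Fin n → ZMod d, (y : (Fin n → ZMod d) ⧸ D) = c → h x ≤ h y := by
    intro c
    obtain ⟨x₀, rfl⟩ := QuotientAddGroup.mk_surjective c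
    obtain ⟨x, hx, hmin⟩ := Set.exists_min_image
      {x : Fin n → ZMod d | (x : (Fin n → ZMod d) ⧸ D) = x₀} h (Set.toFinite _) ⟨x₀, rfl⟩
    exact ⟨x, hx, hmin⟩
  choose pick hpick hmin using hex
  have hrel : ∀ x g : Fin n → ZMod d, x - g ∈ D ↔
      (g : (Fin n → ZMod d) ⧸ D) = x := by
    intro x g
    rw [QuotientAddGroup.eq, neg_add_eq_sub]
  refine ⟨Set.range pick, ?_, ?_⟩
  · intro y
    refine ⟨pick y, ⟨⟨_, rfl⟩, (hD _).2 ((hrel _ _).2 (hpick _))⟩, ?_⟩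
    rintro _ ⟨⟨c, rfl⟩, hc⟩
    rw [hD, hrel, hpick] at hc
    rw [hc]
  · intro x hx
    refine ⟨pick x, fun h' => hx ⟨_, h'⟩, (hD _).2 ((hrel _ _).2 (hpick _)), hmin _ _ rfl⟩

lemma isProbDist_margin1 {Y : Type*} [Fintype Y] {P : Y × Y → ℝ} (hP : IsProbDist P) :
    IsProbDist (margin1 P) :=
  ⟨fun _ => Finset.sum_nonneg fun _ _ => hP.1 _, by
    rw [← hP.2, Fintype.sum_prod_type]; rfl⟩

lemma isProbDist_margin2 {Y : Type*} [Fintype Y] {P : Y × Y → ℝ} (hP : IsProbDist P) :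
    IsProbDist (margin2 P) :=
  ⟨fun _ => Finset.sum_nonneg fun _ _ => hP.1 _, by
    rw [← hP.2, Fintype.sum_prod_type_right]; rfl⟩

lemma pn_margin1 {Y : Type*} [Fintype Y] {n : ℕ} (P : Y × Y → ℝ) (S : Set (Fin n → Y)) :
    pn (margin1 P) S = pn P {w | (fun i => (w i).1) ∈ S} := by
  classical
  unfold pn
  rw [← (Equiv.arrowProdEquivProdArrow (Fin n) (fun _ => Y) (fun _ => Y)).symm.sum_comp,
    Fintype.sum_prod_type]
  refine Finset.sum_congr rfl fun x _ => ?_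
  have := Finset.prod_univ_sum (fun _ : Fin n => (Finset.univ : Finset Y))
    (fun i a => P (x i, a))
  rw [Fintype.piFinset_univ] at this
  by_cases hx : x ∈ S
  · simpa [hx, margin1, Equiv.arrowProdEquivProdArrow] using this
  · simp [hx, Equiv.arrowProdEquivProdArrow]

lemma pn_margin2 {Y : Type*} [Fintype Y] {n : ℕ} (P : Y × Y → ℝ) (S : Set (Fin n → Y)) :
    pn (margin2 P) S = pn P {w | (fun i => (w i).2) ∈ S} := by
  classical
  unfold pn
  rw [← (Equiv.arrowProdEquivProdArrow (Fin n) (fun _ => Y) (fun _ => Y)).symm.sum_comp,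
    Fintype.sum_prod_type_right]
  refine Finset.sum_congr rfl fun x _ => ?_
  have := Finset.prod_univ_sum (fun _ : Fin n => (Finset.univ : Finset Y))
    (fun i a => P (a, x i))
  rw [Fintype.piFinset_univ] at this
  by_cases hx : x ∈ S
  · simpa [hx, margin2, Equiv.arrowProdEquivProdArrow] using this
  · simp [hx, Equiv.arrowProdEquivProdArrow]

lemma pn_compl_Kset_le {d n : ℕ} [NeZero d] {P : ZMod d × ZMod d → ℝ} (hP : IsProbDist P)
    (Γ : Set (Fin n → ZMod d)) :
    pn P (Kset Γ)ᶜ ≤ pn (margin1 P) Γᶜ + pn (margin2 P) Γᶜ := by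
  rw [pn_margin1, pn_margin2]
  unfold pn
  rw [← Finset.sum_add_distrib]
  refine Finset.sum_le_sum fun w _ => ?_
  have hw : 0 ≤ ∏ i, P (w i) := Finset.prod_nonneg fun i _ => hP.1 _
  by_cases h1 : (fun i => (w i).1) ∈ Γ <;> by_cases h2 : (fun i => (w i).2) ∈ Γ
  · have : w ∈ Kset Γ := ⟨_, h1, _, h2, rfl⟩
    simp [this, h1, h2]
  all_goals
    simp only [Set.mem_compl_iff, Set.mem_ofPred_eq, h1, h2, not_true_eq_false, not_false_eq_true,
      if_true, if_false]
    split_ifs <;> linarith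

/-- If finitely many nonnegative quantities have average at most `c t`, some sample point is good
for all of them up to the factor given by their number. -/
lemma exists_forall_le_card_mul {Ω T : Type*} [Fintype Ω] [Nonempty Ω] (s : Finset T)
    (b : T → Ω → ℝ) (c : T → ℝ) (hb : ∀ t ω, 0 ≤ b t ω) (hc : ∀ t ∈ s, 0 < c t)
    (h : ∀ t ∈ s, ∑ ω, b t ω ≤ c t * Fintype.card Ω) :
    ∃ ω, ∀ t ∈ s, b t ω ≤ s.card * c t := by
  have hle : ∑ ω, ∑ t ∈ s, b t ω / c t ≤ ∑ _ω : Ω, (s.card : ℝ) := by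
    rw [Finset.sum_comm]
    calc ∑ t ∈ s, ∑ ω, b t ω / c t ≤ ∑ t ∈ s, (Fintype.card Ω : ℝ) := by
          refine Finset.sum_le_sum fun t ht => ?_
          rw [← Finset.sum_div, div_le_iff₀ (hc t ht), mul_comm]
          exact h t ht
      _ = _ := by simp [mul_comm]
  obtain ⟨ω, -, hω⟩ := Finset.exists_le_of_sum_le Finset.univ_nonempty hle
  refine ⟨ω, fun t ht => ?_⟩
  rw [← div_le_iff₀ (hc t ht)]
  refine le_trans ?_ hω
  exact Finset.single_le_sum (f := fun t => b t ω / c t)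
    (fun t' ht' => div_nonneg (hb _ _) (hc t' ht').le) ht

/-- There are few words whose empirical entropy is at most a given bound. -/
lemma card_entd_le {d n : ℕ} [NeZero d] (hd : 2 ≤ d) (hn : 0 < n) (e : ℝ) :
    ((Finset.univ.filter fun x : Fin n → ZMod d => entd d (freq n (letterCount x)) ≤ e).card : ℝ)
      ≤ (types (ZMod d) n).card * (d : ℝ) ^ ((n : ℝ) * e) := by
  rw [Finset.card_eq_sum_card_fiberwise (f := letterCount) (t := types (ZMod d) n)
    (fun x _ => Finset.mem_image_of_mem _ (Finset.mem_univ x)), Nat.cast_sum, ← nsmul_eq_mul]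
  refine Finset.sum_le_card_nsmul _ _ _ fun t ht => ?_
  by_cases h : entd d (freq n t) ≤ e
  · have hd1 : (1 : ℝ) ≤ d := by exact_mod_cast (by omega : 1 ≤ d)
    refine le_trans ?_ ((card_typeClass_le hd hn ht).trans
      (Real.rpow_le_rpow_of_exponent_le hd1 (by gcongr)))
    exact_mod_cast Finset.card_le_card fun x hx => by
      simp only [Finset.mem_filter, Finset.mem_univ, true_and, typeClass] at hx ⊢
      exact hx.2
  · rw [Finset.card_eq_zero.mpr]
    · simp only [Nat.cast_zero]; positivity
    · ext x
      simp only [Finset.mem_filter, Finset.mem_univ, true_and, Finset.notMem_empty, iff_false,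
        not_and]
      rintro hx rfl
      exact h hx

open Classical in
/-- Minimum entropy decoding: in an ensemble of codes whose duals contain each nonzero word with
probability at most `c * d ^ (-s)`, some code has a transversal with a small proportion of
undecodable words in every type class. -/
lemma exists_code_of_ensemble {d n : ℕ} [NeZero d] (hd : 2 ≤ d) (hn : 0 < n) {Ω : Type*}
    [Fintype Ω] [Nonempty Ω] (C : Ω → Submodule (ZMod d) (Fin n → ZMod d)) (s c : ℝ) (hc : 1 ≤ c)
    (hC : ∀ y : Fin n → ZMod d, y ≠ 0 →
      (Nat.card {ω // y ∈ dualSet (C ω : Set (Fin n → ZMod d))} : ℝ) ≤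
        c * (d : ℝ) ^ (-s) * Fintype.card Ω) :
    ∃ (ω : Ω) (Γ : Set (Fin n → ZMod d)), IsTransversal (C ω : Set (Fin n → ZMod d)) Γ ∧
      ∀ t ∈ types (ZMod d) n, (((typeClass n t).filter (· ∉ Γ)).card : ℝ) ≤
        (types (ZMod d) n).card * ((typeClass n t).card *
          (c * (types (ZMod d) n).card *
            (d : ℝ) ^ (-max (s - n * entd d (freq n t)) 0))) := by
  have hd0 : (0 : ℝ) < d := by positivity
  choose Γ hΓ hmin using fun ω => exists_transversal_minimizing (C ω)
    fun x => entd d (freq n (letterCount x))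
  have hM : (1 : ℝ) ≤ (types (ZMod d) n).card := by
    exact_mod_cast Finset.card_pos.mpr
      (Finset.Nonempty.image Finset.univ_nonempty _)
  have hbad : ∀ x : Fin n → ZMod d,
      ((Finset.univ.filter fun ω => x ∉ Γ ω).card : ℝ) ≤
        c * (types (ZMod d) n).card *
          (d : ℝ) ^ (-max (s - n * entd d (freq n (letterCount x))) 0) * Fintype.card Ω := by
    intro x
    rcases le_total (s - n * entd d (freq n (letterCount x))) 0 with h | h
    · rw [max_eq_right h, neg_zero, Real.rpow_zero, mul_one]
      calc ((Finset.univ.filter fun ω => x ∉ Γ ω).card : ℝ) ≤ 1 * Fintype.card Ω := by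
            rw [one_mul]; exact_mod_cast Finset.card_le_univ _
        _ ≤ _ := by gcongr; nlinarith
    · rw [max_eq_left h]
      let L := Finset.univ.filter fun g : Fin n → ZMod d =>
        entd d (freq n (letterCount g)) ≤ entd d (freq n (letterCount x))
      have hsub : (Finset.univ.filter fun ω => x ∉ Γ ω) ⊆
          (L.erase x).biUnion fun g => Finset.univ.filter fun ω =>
            x - g ∈ dualSet (C ω : Set (Fin n → ZMod d)) := by
        intro ω hω
        obtain ⟨g, hgx, hg, hle⟩ := hmin ω x (Finset.mem_filter.mp hω).2
        exact Finset.mem_biUnion.mpr ⟨g, by simp [L, hgx, hle], by simp [hg]⟩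
      have h1 : ((Finset.univ.filter fun ω => x ∉ Γ ω).card : ℝ) ≤
          ∑ g ∈ L.erase x, ((Finset.univ.filter fun ω =>
            x - g ∈ dualSet (C ω : Set (Fin n → ZMod d))).card : ℝ) := by
        exact_mod_cast (Finset.card_le_card hsub).trans Finset.card_biUnion_le
      have h2 : ∀ g ∈ L.erase x, ((Finset.univ.filter fun ω =>
            x - g ∈ dualSet (C ω : Set (Fin n → ZMod d))).card : ℝ) ≤
          c * (d : ℝ) ^ (-s) * Fintype.card Ω := by
        intro g hg
        have := hC (x - g) (sub_ne_zero.mpr (Finset.ne_of_mem_erase hg).symm)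
        rwa [Nat.card_eq_fintype_card, Fintype.card_subtype] at this
      have h3 : ((L.erase x).card : ℝ) ≤ (types (ZMod d) n).card *
          (d : ℝ) ^ ((n : ℝ) * entd d (freq n (letterCount x))) :=
        le_trans (by exact_mod_cast Finset.card_le_card (Finset.erase_subset _ _))
          (card_entd_le hd hn _)
      refine (h1.trans (Finset.sum_le_card_nsmul _ _ _ h2)).trans ?_
      rw [nsmul_eq_mul]
      calc _ ≤ ((types (ZMod d) n).card *
            (d : ℝ) ^ ((n : ℝ) * entd d (freq n (letterCount x)))) *
              (c * (d : ℝ) ^ (-s) * Fintype.card Ω) := by gcongr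
        _ = _ := by
          rw [neg_sub, sub_eq_add_neg, Real.rpow_add hd0]; ring
  obtain ⟨ω, hω⟩ := exists_forall_le_card_mul (types (ZMod d) n)
    (fun t ω => (((typeClass n t).filter (· ∉ Γ ω)).card : ℝ))
    (fun t => (typeClass n t).card * (c * (types (ZMod d) n).card *
            (d : ℝ) ^ (-max (s - n * entd d (freq n t)) 0)))
    (fun _ _ => Nat.cast_nonneg _)
    (fun t ht => by
      obtain ⟨x, -, hx⟩ := Finset.mem_image.mp ht
      have : 0 < (typeClass n t).card := Finset.card_pos.mpr ⟨x, by simp [typeClass, hx]⟩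
      positivity)
    (fun t _ => by
      have hswap : ∑ ω, (((typeClass n t).filter (· ∉ Γ ω)).card : ℝ) =
          ∑ x ∈ typeClass n t, ((Finset.univ.filter fun ω => x ∉ Γ ω).card : ℝ) := by
        simp only [Finset.card_filter, Nat.cast_sum]
        exact Finset.sum_comm
      rw [hswap, mul_assoc, ← nsmul_eq_mul]
      refine Finset.sum_le_card_nsmul _ _ _ fun x hx => ?_
      have := hbad x
      rwa [(Finset.mem_filter.mp hx).2] at this)
  exact ⟨ω, Γ ω, hΓ ω, hω⟩

open Classical in
lemma pn_compl_le_of_forall_types {d n : ℕ} [NeZero d] (hd : 2 ≤ d) (hn : 0 < n) {R c : ℝ}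
    (hc : 0 ≤ c) {Γ : Set (Fin n → ZMod d)}
    (hΓ : ∀ t ∈ types (ZMod d) n, (((typeClass n t).filter (· ∉ Γ)).card : ℝ) ≤
        (types (ZMod d) n).card * ((typeClass n t).card *
          (c * (types (ZMod d) n).card *
            (d : ℝ) ^ (-max (n * (1 - R) / 2 - n * entd d (freq n t)) 0))))
    {p : ZMod d → ℝ} (hp : IsProbDist p) :
    pn p Γᶜ ≤ c * ((types (ZMod d) n).card : ℝ) ^ 3 * (d : ℝ) ^ (-(n : ℝ) * Estar d R p) := by
  have hd1 : (1 : ℝ) ≤ d := by exact_mod_cast (by omega : 1 ≤ d)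
  have hd0 : (0 : ℝ) < d := by linarith
  set M : ℝ := ((types (ZMod d) n).card : ℝ) with hM
  have hsum : pn p Γᶜ = ∑ t ∈ types (ZMod d) n,
      (((typeClass n t).filter (· ∉ Γ)).card : ℝ) * ∏ a, p a ^ t a := by
    rw [pn, ← Finset.sum_fiberwise_of_maps_to (g := letterCount) (t := types (ZMod d) n)
      (fun x _ => Finset.mem_image_of_mem _ (Finset.mem_univ x))]
    refine Finset.sum_congr rfl fun t _ => ?_
    change ∑ x ∈ typeClass n t, _ = _
    rw [← nsmul_eq_mul, ← Finset.sum_const, Finset.sum_filter]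
    exact Finset.sum_congr rfl fun x hx => by
      simp only [prod_eq_of_mem_typeClass hx, Set.mem_compl_iff]
  have hterm : ∀ t ∈ types (ZMod d) n,
      (((typeClass n t).filter (· ∉ Γ)).card : ℝ) * ∏ a, p a ^ t a ≤
        c * M ^ 2 * (d : ℝ) ^ (-(n : ℝ) * Estar d R p) := by
    intro t ht
    have hprod : 0 ≤ ∏ a, p a ^ t a := Finset.prod_nonneg fun a _ => pow_nonneg (hp.1 a) _
    by_cases hac : ∀ a, p a = 0 → freq n t a = 0
    · have hfreq : IsProbDist (freq n t) := by
        obtain ⟨x, -, rfl⟩ := Finset.mem_image.mp ht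
        exact isProbDist_freq hn x
      have hE := Estar_le hd R hfreq hp hac
      have hmax : max ((n : ℝ) * (1 - R) / 2 - n * entd d (freq n t)) 0 =
          n * (2⁻¹ * max (1 - 2 * entd d (freq n t) - R) 0) := by
        rw [← mul_assoc, mul_max_of_nonneg _ _ (by positivity), mul_zero]
        congr 1; ring
      calc _ ≤ (M * ((typeClass n t).card * (c * M *
              (d : ℝ) ^ (-max (n * (1 - R) / 2 - n * entd d (freq n t)) 0)))) *
              ∏ a, p a ^ t a := by gcongr; exact hΓ t ht
        _ = c * M ^ 2 * ((d : ℝ) ^ (-max (n * (1 - R) / 2 - n * entd d (freq n t)) 0) *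
              ((typeClass n t).card * ∏ a, p a ^ t a)) := by ring
        _ ≤ c * M ^ 2 * ((d : ℝ) ^ (-max (n * (1 - R) / 2 - n * entd d (freq n t)) 0) *
              (d : ℝ) ^ (-((n : ℝ) * kld d (freq n t) p))) := by
            gcongr; exact card_typeClass_mul_prod_le hd hn ht hp hac
        _ ≤ _ := by
            rw [← Real.rpow_add hd0, hmax]
            gcongr
            have := mul_le_mul_of_nonneg_left hE (Nat.cast_nonneg (α := ℝ) n)
            linarith
    · push Not at hac
      obtain ⟨a, ha, hta⟩ := hac
      have : t a ≠ 0 := by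
        rintro h
        exact hta (by simp [freq, h])
      rw [Finset.prod_eq_zero (Finset.mem_univ a) (by rw [ha, zero_pow this]), mul_zero]
      positivity
  rw [hsum]
  refine (Finset.sum_le_card_nsmul _ _ _ hterm).trans (le_of_eq ?_)
  rw [nsmul_eq_mul, ← hM]; ring

lemma inv_pow_add_inv_pow_le {d n q r k : ℕ} (hd3 : 3 ≤ d) {R : ℝ} (hR0 : 0 ≤ R)
    (hq : 1 ≤ q) (hr : r < 4) (hn : n = 4 * q + r)
    (hk : k = min (2 * q) ⌊(n : ℝ) * (1 - R) / 2⌋₊) :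
    ((d : ℝ) ^ k)⁻¹ + ((d : ℝ) ^ (2 * q - 1))⁻¹ ≤
      (d : ℝ) ^ d * (d : ℝ) ^ (-((n : ℝ) * (1 - R) / 2)) := by
  have hd3' : (3 : ℝ) ≤ d := by exact_mod_cast hd3
  have hd0 : (0 : ℝ) < d := by linarith
  have hd1 : (1 : ℝ) ≤ d := by linarith
  set s : ℝ := (n : ℝ) * (1 - R) / 2 with hs
  have hr' : (r : ℝ) ≤ 3 := by exact_mod_cast (by omega : r ≤ 3)
  have hs2 : s ≤ 2 * q + 3 / 2 := by
    have : (n : ℝ) = 4 * q + r := by exact_mod_cast hn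
    have hnR : 0 ≤ (n : ℝ) * R := by positivity
    rw [hs]; linarith
  have hks : s - 2 ≤ k := by
    rw [hk, Nat.cast_min]
    refine le_min (by push_cast; linarith) ?_
    have := Nat.lt_floor_add_one s
    linarith
  have h1 : ((d : ℝ) ^ k)⁻¹ ≤ (d : ℝ) ^ (2 : ℝ) * (d : ℝ) ^ (-s) := by
    rw [← Real.rpow_natCast, ← Real.rpow_neg hd0.le, ← Real.rpow_add hd0]
    exact Real.rpow_le_rpow_of_exponent_le hd1 (by linarith)
  have h2 : ((d : ℝ) ^ (2 * q - 1))⁻¹ ≤ (d : ℝ) ^ (5 / 2 : ℝ) * (d : ℝ) ^ (-s) := by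
    rw [← Real.rpow_natCast, ← Real.rpow_neg hd0.le, ← Real.rpow_add hd0,
      Nat.cast_sub (by omega)]
    push_cast
    exact Real.rpow_le_rpow_of_exponent_le hd1 (by linarith)
  have h3 : (d : ℝ) ^ (2 : ℝ) + (d : ℝ) ^ (5 / 2 : ℝ) ≤ (d : ℝ) ^ d := by
    have h4 : (d : ℝ) ^ (5 / 2 : ℝ) = (d : ℝ) ^ 2 * √d := by
      rw [Real.sqrt_eq_rpow, ← Real.rpow_natCast, ← Real.rpow_add hd0]; norm_num
    have h5 : 1 + √(d : ℝ) ≤ d := by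
      have h6 : √(d : ℝ) ≤ d - 1 := Real.sqrt_le_iff.mpr ⟨by linarith, by nlinarith⟩
      linarith
    calc (d : ℝ) ^ (2 : ℝ) + (d : ℝ) ^ (5 / 2 : ℝ) = (d : ℝ) ^ 2 * (1 + √d) := by
          rw [h4, Real.rpow_two]; ring
      _ ≤ (d : ℝ) ^ 2 * d := by gcongr
      _ = (d : ℝ) ^ 3 := by ring
      _ ≤ _ := pow_le_pow_right₀ hd1 hd3
  calc _ ≤ (d : ℝ) ^ (2 : ℝ) * (d : ℝ) ^ (-s) + (d : ℝ) ^ (5 / 2 : ℝ) * (d : ℝ) ^ (-s) :=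
        add_le_add h1 h2
    _ = ((d : ℝ) ^ (2 : ℝ) + (d : ℝ) ^ (5 / 2 : ℝ)) * (d : ℝ) ^ (-s) := by ring
    _ ≤ _ := by gcongr

theorem stmt_0 (d : ℕ) [NeZero d] (hd : d.Prime) (hd3 : 3 ≤ d)
    (R : ℝ) (hR0 : 0 ≤ R) (hR1 : R ≤ 1) :
    ∃ N₀ : ℕ, ∀ n : ℕ, N₀ ≤ n →
      ∃ (C : Submodule (ZMod d) (Fin n → ZMod d)) (Γ : Set (Fin n → ZMod d)),
        (C : Set (Fin n → ZMod d)) ⊆ dualSet (C : Set (Fin n → ZMod d)) ∧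
        (n : ℝ) - 2 * (Module.finrank (ZMod d) C : ℝ) ≥ (n : ℝ) * R ∧
        IsTransversal (C : Set (Fin n → ZMod d)) Γ ∧
        ∀ P : ZMod d × ZMod d → ℝ, IsProbDist P →
          pn P (Kset Γ)ᶜ ≤ pn (margin1 P) Γᶜ + pn (margin2 P) Γᶜ ∧
          pn (margin1 P) Γᶜ + pn (margin2 P) Γᶜ ≤
            2 * (d : ℝ) ^ d * ((n : ℝ) + 1) ^ (3 * (d - 1)) *
              (d : ℝ) ^ (-(n : ℝ) * min (Estar d R (margin1 P)) (Estar d R (margin2 P))) := by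
  classical
  have : Fact d.Prime := ⟨hd⟩
  have hd2 : 2 ≤ d := by omega
  have hd1 : (1 : ℝ) ≤ d := by exact_mod_cast (by omega : 1 ≤ d)
  refine ⟨4, fun n hn => ?_⟩
  have hn0 : 0 < n := by omega
  obtain ⟨k, hk⟩ : ∃ k, k = min (2 * (n / 4)) ⌊(n : ℝ) * (1 - R) / 2⌋₊ := ⟨_, rfl⟩
  have hdiv : n = 4 * (n / 4) + n % 4 := (Nat.div_add_mod n 4).symm
  obtain ⟨Ω, _, _, C, hself, hrank, hdual⟩ :=
    exists_selfOrthogonal_ensemble (d := d) hd3 n (n / 4) (n % 4) k hdiv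
  have hε := inv_pow_add_inv_pow_le hd3 hR0 (by omega) (Nat.mod_lt n (by norm_num)) hdiv hk
  obtain ⟨ω, Γ, hΓ, hbad⟩ := exists_code_of_ensemble hd2 hn0 C ((n : ℝ) * (1 - R) / 2)
    ((d : ℝ) ^ d) (one_le_pow₀ hd1) fun y hy => (hdual y hy).trans (by gcongr)
  refine ⟨C ω, Γ, hself ω, ?_, hΓ, fun P hP => ⟨pn_compl_Kset_le hP Γ, ?_⟩⟩
  · have h1 : (Module.finrank (ZMod d) (C ω) : ℝ) ≤ k := by exact_mod_cast hrank ω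
    have h2 : (k : ℝ) ≤ ⌊(n : ℝ) * (1 - R) / 2⌋₊ := by
      rw [hk]; exact_mod_cast min_le_right _ _
    have h3 : (⌊(n : ℝ) * (1 - R) / 2⌋₊ : ℝ) ≤ (n : ℝ) * (1 - R) / 2 :=
      Nat.floor_le (div_nonneg (mul_nonneg (Nat.cast_nonneg n) (by linarith)) (by norm_num))
    linarith
  · have hM : ((types (ZMod d) n).card : ℝ) ^ 3 ≤ ((n : ℝ) + 1) ^ (3 * (d - 1)) := by
      have h := card_types_le (ZMod d) n
      rw [ZMod.card] at h
      rw [mul_comm 3 (d - 1), pow_mul]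
      exact pow_le_pow_left₀ (Nat.cast_nonneg _) (by exact_mod_cast h) 3
    have hbound : ∀ p : ZMod d → ℝ, IsProbDist p → ∀ E ≤ Estar d R p,
        pn p Γᶜ ≤ (d : ℝ) ^ d * ((n : ℝ) + 1) ^ (3 * (d - 1)) * (d : ℝ) ^ (-(n : ℝ) * E) := by
      intro p hp E hE
      refine (pn_compl_le_of_forall_types hd2 hn0 (by positivity) hbad hp).trans ?_
      gcongr ?_ * ?_ * ?_
      exact Real.rpow_le_rpow_of_exponent_le hd1
        (mul_le_mul_of_nonpos_left hE (neg_nonpos.mpr (Nat.cast_nonneg n)))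
    have h1 := hbound _ (isProbDist_margin1 hP) _ (min_le_left _ (Estar d R (margin2 P)))
    have h2 := hbound _ (isProbDist_margin2 hP) _ (min_le_right (Estar d R (margin1 P)) _)
    linarith

end
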